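/- Let τ be the Tit-for-Tat-anti-Tit-for-Tat (TFT-ATFT) memory-two strategy: τ(s1,s2) = C exactly when [s1 = (C,C)], or [s1 = (C,D) and s2 = (D,D)], or [s1 = (D,C) and s2 ∈ {(C,D),(D,D)}], or [s1 = (D,D) and s2 ∈ {(C,C),(D,C)}]; otherwise τ(s1,s2) = D. Set τ2(s1,s2) := τ(π(s1), π(s2)). Then for any prisoner's dilemma payoffs T > R > P > S with 2R > T + S and any γ ∈ [0,1), the pair (τ, τ2) does not form a symmetric mutual reinforcement learning equilibrium: there do not exist Q1, Q2 : {C,D} × Ω × Ω → ℝ such that Q1 satisfies the player-1 memory-two Bellman optimality equation against τ2 with τ strictly greedy for Q1, and Q2 satisfies the player-2 memory-two Bellman optimality equation against τ with τ2 strictly greedy for Q2. -/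

import Mathlib

inductive Act where
  | C : Act
  | D : Act
deriving DecidableEq

open Act

abbrev St : Type := Act × Act

/-- Player 1's payoff in the prisoner's dilemma. -/
def r1 (R S T P : ℝ) : Act → Act → ℝ
  | C, C => R
  | C, D => S
  | D, C => T
  | D, D => P

/-- Swap the roles of the two players in a state. -/
def pi' (s : St) : St := (s.2, s.1)

/-- The Tit-for-Tat-anti-Tit-for-Tat (TFT-ATFT) memory-two strategy. -/
def tftatft : St → St → Act := fun s1 s2 =>
  if s1 = (C, C) ∨ (s1 = (C, D) ∧ s2 = (D, D)) ∨
      (s1 = (D, C) ∧ (s2 = (C, D) ∨ s2 = (D, D))) ∨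
      (s1 = (D, D) ∧ (s2 = (C, C) ∨ s2 = (D, C)))
  then C else D

/-- TFT-ATFT cannot form a symmetric mutual reinforcement learning
equilibrium for any prisoner's dilemma payoffs and any discount factor. -/
theorem stmt_5 (R S T P γ : ℝ) (hTR : T > R) (hRP : R > P) (hPS : P > S)
    (h2R : 2 * R > T + S) (hγ0 : 0 ≤ γ) (hγ1 : γ < 1) :
    ¬ ∃ Q1 Q2 : Act → St → St → ℝ,
      (∀ σ s1 s2, Q1 σ s1 s2 =
        r1 R S T P σ (tftatft (pi' s1) (pi' s2)) +
          γ * max (Q1 C (σ, tftatft (pi' s1) (pi' s2)) s1)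
            (Q1 D (σ, tftatft (pi' s1) (pi' s2)) s1)) ∧
      (∀ s1 s2, (tftatft s1 s2 = C → Q1 C s1 s2 > Q1 D s1 s2) ∧
        (tftatft s1 s2 = D → Q1 D s1 s2 > Q1 C s1 s2)) ∧
      (∀ σ s1 s2, Q2 σ s1 s2 =
        r1 R S T P σ (tftatft s1 s2) +
          γ * max (Q2 C (tftatft s1 s2, σ) s1) (Q2 D (tftatft s1 s2, σ) s1)) ∧
      (∀ s1 s2, (tftatft (pi' s1) (pi' s2) = C → Q2 C s1 s2 > Q2 D s1 s2) ∧
        (tftatft (pi' s1) (pi' s2) = D → Q2 D s1 s2 > Q2 C s1 s2)) := by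
  rintro ⟨Q1, Q2, bellman, greedy, -, -⟩
  -- After `(D, D)`, the second-to-last states `(D, D)` and `(D, C)` provoke the same reaction of
  -- player 2, so player 1's action values agree, while player 1's prescribed actions differ.
  have value_eq (σ : Act) : Q1 σ (D, D) (D, D) = Q1 σ (D, D) (D, C) := by
    rw [bellman σ (D, D) (D, D), bellman σ (D, D) (D, C)]
    rfl
  have defect := (greedy (D, D) (D, D)).2 rfl
  have cooperate := (greedy (D, D) (D, C)).1 rfl
  rw [value_eq C, value_eq D] at defect
  exact lt_asymm defect cooperate
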